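/- arXiv:2205.01405 — 2 statements merged into one kernel-verified Lean document; each statement's English description precedes it below -/
import Mathlib

section
/- Let Q be an inverse semigroup which is completely semisimple, in the sense that for all idempotents e, f of Q, if e ≤_𝓛 f and e 𝓙 f then e = f, and which satisfies the ascending chain condition on the ≤_𝓙-order, in the sense that there is no sequence q : ℕ → Q such that for every n, q(n) ≤_𝓙 q(n+1) and not q(n+1) ≤_𝓙 q(n). Then every subsemigroup S of Q that is a left I-order in Q is a straight left I-order in Q. -/
/-- The 𝓙-preorder on a semigroup: `a` lies in the two-sided principal ideal of `b`. -/
def leJ {Q : Type*} [Semigroup Q] (a b : Q) : Prop :=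
  a = b ∨ (∃ x, a = x * b) ∨ (∃ y, a = b * y) ∨ ∃ x y, a = x * b * y

section InverseSemigroup

variable {Q : Type*} [Semigroup Q]

/-- If idempotents commute, inverses in a semigroup are unique. -/
theorem inverse_unique_of_idempotents_commute
    (hcomm : ∀ e f : Q, e * e = e → f * f = f → e * f = f * e)
    {a x y : Q} (hx : a * x * a = a) (hx' : x * a * x = x)
    (hy : a * y * a = a) (hy' : y * a * y = y) : x = y := by
  have hxa : (x * a) * (x * a) = x * a := by rw [← mul_assoc, hx']
  have hya : (y * a) * (y * a) = y * a := by rw [← mul_assoc, hy']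
  have hax : (a * x) * (a * x) = a * x := by rw [← mul_assoc, hx]
  have hay : (a * y) * (a * y) = a * y := by rw [← mul_assoc, hy]
  calc x = x * (a * y * a) * x := by rw [hy, hx']
    _ = ((x * a) * (y * a)) * x := by simp only [mul_assoc]
    _ = ((y * a) * (x * a)) * x := by rw [hcomm _ _ hxa hya]
    _ = y * a * (x * a * x) := by simp only [mul_assoc]
    _ = y * a * x := by rw [hx']
    _ = y * a * y * a * x := by rw [hy']
    _ = y * ((a * y) * (a * x)) := by simp only [mul_assoc]
    _ = y * ((a * x) * (a * y)) := by rw [hcomm _ _ hay hax]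
    _ = y * (a * x * a) * y := by simp only [mul_assoc]
    _ = y := by rw [hx, hy']

theorem inv_eq_self_of_idempotent
    (inv : Q → Q)
    (hinv1 : ∀ a : Q, a * inv a * a = a)
    (hinv2 : ∀ a : Q, inv a * a * inv a = inv a)
    (hcomm : ∀ e f : Q, e * e = e → f * f = f → e * f = f * e)
    {e : Q} (he : e * e = e) : inv e = e :=
  inverse_unique_of_idempotents_commute hcomm (hinv1 e) (hinv2 e)
    (by rw [he, he]) (by rw [he, he])

theorem inverse_semigroup_inv_inv
    (inv : Q → Q)
    (hinv1 : ∀ a : Q, a * inv a * a = a)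
    (hinv2 : ∀ a : Q, inv a * a * inv a = inv a)
    (hcomm : ∀ e f : Q, e * e = e → f * f = f → e * f = f * e)
    (a : Q) : inv (inv a) = a :=
  inverse_unique_of_idempotents_commute hcomm (hinv1 _) (hinv2 _) (hinv2 a) (hinv1 a)

theorem inverse_semigroup_mul_inv_rev
    (inv : Q → Q)
    (hinv1 : ∀ a : Q, a * inv a * a = a)
    (hinv2 : ∀ a : Q, inv a * a * inv a = inv a)
    (hcomm : ∀ e f : Q, e * e = e → f * f = f → e * f = f * e)
    (a b : Q) : inv (a * b) = inv b * inv a := by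
  have ha : (inv a * a) * (inv a * a) = inv a * a := by rw [← mul_assoc, hinv2]
  have hb : (b * inv b) * (b * inv b) = b * inv b := by rw [← mul_assoc, hinv1]
  have hc := hcomm _ _ ha hb
  refine inverse_unique_of_idempotents_commute hcomm (hinv1 _) (hinv2 _) ?_ ?_
  · calc a * b * (inv b * inv a) * (a * b)
        = a * ((b * inv b) * (inv a * a)) * b := by simp only [mul_assoc]
      _ = (a * inv a * a) * (b * inv b * b) := by rw [← hc]; simp only [mul_assoc]
      _ = a * b := by rw [hinv1, hinv1]
  · calc inv b * inv a * (a * b) * (inv b * inv a)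
        = inv b * ((inv a * a) * (b * inv b)) * inv a := by simp only [mul_assoc]
      _ = (inv b * b * inv b) * (inv a * a * inv a) := by rw [hc]; simp only [mul_assoc]
      _ = inv b * inv a := by rw [hinv2, hinv2]

/-- A left I-order in a completely semisimple inverse semigroup with the ascending chain condition
on the 𝓙-order meets the 𝓛-class of every idempotent. -/
theorem leftIOrder_meets_L_class
    (inv : Q → Q)
    (hinv1 : ∀ a : Q, a * inv a * a = a)
    (hinv2 : ∀ a : Q, inv a * a * inv a = inv a)
    (hcomm : ∀ e f : Q, e * e = e → f * f = f → e * f = f * e)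
    (hss : ∀ e f : Q, e * e = e → f * f = f →
      inv e * e * (inv f * f) = inv e * e → leJ e f → leJ f e → e = f)
    (hacc : ¬ ∃ q : ℕ → Q, ∀ n : ℕ, leJ (q n) (q (n + 1)) ∧ ¬ leJ (q (n + 1)) (q n))
    (S : Subsemigroup Q)
    (hIorder : ∀ q : Q, ∃ a b : Q, a ∈ S ∧ b ∈ S ∧ q = inv a * b)
    (e : Q) (he : e * e = e) : ∃ u ∈ S, inv u * u = e := by
  have wf : WellFounded fun x y : Q => leJ y x ∧ ¬ leJ x y :=
    wellFounded_iff_isEmpty_descending_chain.2 ⟨fun q => hacc ⟨q.1, q.2⟩⟩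
  induction e using wf.induction with
  | _ e ih =>
  obtain ⟨a, b, ha, hb, hab⟩ := hIorder e
  have haa : (a * inv a) * (a * inv a) = a * inv a := by rw [← mul_assoc, hinv1]
  have haa' : (inv a * a) * (inv a * a) = inv a * a := by rw [← mul_assoc, hinv2]
  have hae : inv a * a * e = e := by rw [hab, ← mul_assoc, hinv2]
  by_cases h : leJ (a * inv a) e
  · refine ⟨a, ha, (hss _ _ he haa' ?_ (.inr (.inr (.inl ⟨e, hae.symm⟩))) ?_).symm⟩
    · rw [inv_eq_self_of_idempotent inv hinv1 hinv2 hcomm he,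
        inv_eq_self_of_idempotent inv hinv1 hinv2 hcomm haa', he, haa', hcomm _ _ he haa', hae]
    · have key : inv a * a = inv a * (a * inv a) * a := by rw [← mul_assoc, hinv2]
      rcases h with h | ⟨x, h⟩ | ⟨y, h⟩ | ⟨x, y, h⟩
      · exact .inr (.inr (.inr ⟨inv a, a, by rw [key, h]⟩))
      · exact .inr (.inr (.inr ⟨inv a * x, a, by rw [key, h]; simp only [mul_assoc]⟩))
      · exact .inr (.inr (.inr ⟨inv a, y * a, by rw [key, h]; simp only [mul_assoc]⟩))
      · exact .inr (.inr (.inr ⟨inv a * x, y * a, by rw [key, h]; simp only [mul_assoc]⟩))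
  · have hle : leJ e (a * inv a) :=
      .inr (.inr (.inr ⟨inv a, b, by rw [← mul_assoc, hinv2, hab]⟩))
    obtain ⟨u, hu, hua⟩ := ih _ ⟨hle, h⟩ haa
    refine ⟨u * b, S.mul_mem hu hb, ?_⟩
    calc inv (u * b) * (u * b) = inv b * (inv u * u) * b := by
          rw [inverse_semigroup_mul_inv_rev inv hinv1 hinv2 hcomm]; simp only [mul_assoc]
      _ = inv e * e := by
          rw [hua, hab, inverse_semigroup_mul_inv_rev inv hinv1 hinv2 hcomm,
            inverse_semigroup_inv_inv inv hinv1 hinv2 hcomm]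
          simp only [mul_assoc]
      _ = e := by rw [inv_eq_self_of_idempotent inv hinv1 hinv2 hcomm he, he]

end InverseSemigroup

/-- In a completely semisimple inverse semigroup with the ascending
chain condition on the ≤_𝓙-order, every left I-order is straight. -/
theorem leftIOrder_straight_of_css_acc
    {Q : Type*} [Semigroup Q] (inv : Q → Q)
    (hinv1 : ∀ a : Q, a * inv a * a = a)
    (hinv2 : ∀ a : Q, inv a * a * inv a = inv a)
    (hcomm : ∀ e f : Q, e * e = e → f * f = f → e * f = f * e)
    (hss : ∀ e f : Q, e * e = e → f * f = f →
      inv e * e * (inv f * f) = inv e * e → leJ e f → leJ f e → e = f)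
    (hacc : ¬ ∃ q : ℕ → Q, ∀ n : ℕ, leJ (q n) (q (n + 1)) ∧ ¬ leJ (q (n + 1)) (q n))
    (S : Subsemigroup Q)
    (hIorder : ∀ q : Q, ∃ a b : Q, a ∈ S ∧ b ∈ S ∧ q = inv a * b) :
    ∀ q : Q, ∃ a b : Q, a ∈ S ∧ b ∈ S ∧ q = inv a * b ∧ a * inv a = b * inv b := by
  intro q
  obtain ⟨a, b, ha, hb, hab⟩ := hIorder q
  have haa : (a * inv a) * (a * inv a) = a * inv a := by rw [← mul_assoc, hinv1]
  have hbb : (b * inv b) * (b * inv b) = b * inv b := by rw [← mul_assoc, hinv1]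
  have hc := hcomm _ _ haa hbb
  have hf1 : (a * inv a) * (b * inv b) * (a * inv a) = (a * inv a) * (b * inv b) := by
    rw [mul_assoc, ← hc, ← mul_assoc, haa]
  have hf2 : (a * inv a) * (b * inv b) * (b * inv b) = (a * inv a) * (b * inv b) := by
    rw [mul_assoc, hbb]
  obtain ⟨u, hu, huf⟩ := leftIOrder_meets_L_class inv hinv1 hinv2 hcomm hss hacc S hIorder
    ((a * inv a) * (b * inv b)) (by rw [← mul_assoc, hf1, hf2])
  have range_mul : ∀ c : Q, inv u * u * (c * inv c) = inv u * u →
      (u * c) * inv (u * c) = u * inv u := fun c hcu =>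
    calc (u * c) * inv (u * c) = (u * inv u * u) * (c * inv c) * inv u := by
          rw [inverse_semigroup_mul_inv_rev inv hinv1 hinv2 hcomm, hinv1]
          simp only [mul_assoc]
      _ = u * (inv u * u * (c * inv c)) * inv u := by simp only [mul_assoc]
      _ = u * inv u := by rw [hcu, ← mul_assoc, hinv1]
  refine ⟨u * a, u * b, S.mul_mem hu ha, S.mul_mem hu hb, ?_, ?_⟩
  · calc q = (inv a * a * inv a) * (b * inv b * b) := by rw [hab, hinv2, hinv1]
      _ = inv a * ((a * inv a) * (b * inv b)) * b := by simp only [mul_assoc]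
      _ = inv (u * a) * (u * b) := by
          rw [← huf, inverse_semigroup_mul_inv_rev inv hinv1 hinv2 hcomm]
          simp only [mul_assoc]
  · rw [range_mul a (by rw [huf, hf1]), range_mul b (by rw [huf, hf2])]
end

section
/- Let S be a right ample semigroup with unary operation star and let R' be a binary relation on S. Then the following are equivalent. (1) There exist an inverse semigroup Q and an injective semigroup homomorphism φ : S → Q with φ(star(a)) = (φ a)⁻¹·(φ a) for all a ∈ S, such that every q ∈ Q can be written as q = (φ a)⁻¹·(φ b) for some a, b ∈ S with φ a 𝓡 φ b in Q, and for all a, b ∈ S: a R' b ⇔ φ a 𝓡 φ b in Q. (2) R' is a left compatible equivalence relation on S satisfying: (A1) for all a, b ∈ S there exist c, d ∈ S with c R' d, d R' (d·b), d·b = c·a and a·star(b) = star(c)·a; (A2) for all a, b, c ∈ S, (c·a) R' (c·b) implies (star(c)·a) R' (star(c)·b); (A3) a R' b implies a 𝓡* b. -/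
universe u

/-- The preorder ≤_{𝓛*} on a semigroup, defined via `S¹ = WithOne S`. -/
def LeLStar {S : Type*} [Semigroup S] (a b : S) : Prop :=
  ∀ x y : WithOne S,
    (b : WithOne S) * x = (b : WithOne S) * y → (a : WithOne S) * x = (a : WithOne S) * y

/-- The relation 𝓡* on a semigroup, defined via `S¹ = WithOne S`. -/
def RStar {S : Type*} [Semigroup S] (a b : S) : Prop :=
  ∀ x y : WithOne S,
    x * (a : WithOne S) = y * (a : WithOne S) ↔ x * (b : WithOne S) = y * (b : WithOne S)

/-- A relation is left compatible if it is preserved by left multiplication. -/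
def LeftCompatible {S : Type*} [Semigroup S] (R : S → S → Prop) : Prop :=
  ∀ c a b : S, R a b → R (c * a) (c * b)

/-- Inverse semigroups. -/
class InverseSemigroup (Q : Type*) extends Semigroup Q, Inv Q where
  mul_inv_mul : ∀ a : Q, a * a⁻¹ * a = a
  inv_mul_inv : ∀ a : Q, a⁻¹ * a * a⁻¹ = a⁻¹
  idem_comm : ∀ e f : Q, e * e = e → f * f = f → e * f = f * e

namespace InverseSemigroup

variable {Q : Type*} [InverseSemigroup Q]

theorem mul_inv_idem (a : Q) : a * a⁻¹ * (a * a⁻¹) = a * a⁻¹ := by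
  rw [← mul_assoc, mul_inv_mul]

theorem inv_mul_idem (a : Q) : a⁻¹ * a * (a⁻¹ * a) = a⁻¹ * a := by
  rw [← mul_assoc, inv_mul_inv]

theorem eq_inv {a x : Q} (h₁ : a * x * a = a) (h₂ : x * a * x = x) : x = a⁻¹ := by
  have e₁ : a * x * (a * x) = a * x := by rw [← mul_assoc, h₁]
  have e₂ : x * a * (x * a) = x * a := by rw [← mul_assoc, h₂]
  have k₁ := idem_comm _ _ e₁ (mul_inv_idem a)
  have k₂ := idem_comm _ _ e₂ (inv_mul_idem a)
  have l₁ : a * x = a * a⁻¹ := by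
    rw [← mul_assoc, h₁, ← mul_assoc, mul_inv_mul] at k₁
    exact k₁.symm
  have l₂ : x * a = a⁻¹ * a := by
    rw [mul_assoc, ← mul_assoc a, mul_inv_mul, mul_assoc, ← mul_assoc a, h₁] at k₂
    exact k₂
  rw [← h₂, l₂, mul_assoc, l₁, ← mul_assoc, inv_mul_inv]

theorem inv_inv' (a : Q) : a⁻¹⁻¹ = a :=
  (eq_inv (inv_mul_inv a) (mul_inv_mul a)).symm

theorem mul_inv_rev' (a b : Q) : (a * b)⁻¹ = b⁻¹ * a⁻¹ := by
  have k := idem_comm _ _ (inv_mul_idem a) (mul_inv_idem b)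
  refine (eq_inv ?_ ?_).symm
  · calc a * b * (b⁻¹ * a⁻¹) * (a * b) = a * (b * b⁻¹ * (a⁻¹ * a)) * b := by
          simp only [mul_assoc]
      _ = (a * a⁻¹ * a) * (b * b⁻¹ * b) := by rw [← k]; simp only [mul_assoc]
      _ = a * b := by rw [mul_inv_mul, mul_inv_mul]
  · calc b⁻¹ * a⁻¹ * (a * b) * (b⁻¹ * a⁻¹) = b⁻¹ * (a⁻¹ * a * (b * b⁻¹)) * a⁻¹ := by
          simp only [mul_assoc]
      _ = (b⁻¹ * b * b⁻¹) * (a⁻¹ * a * a⁻¹) := by rw [k]; simp only [mul_assoc]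
      _ = b⁻¹ * a⁻¹ := by rw [inv_mul_inv, inv_mul_inv]

theorem inv_eq_self {e : Q} (h : e * e = e) : e⁻¹ = e :=
  (eq_inv (by rw [h, h]) (by rw [h, h])).symm

theorem mul_inv_mul_of_eq {a b : Q} (h : a * a⁻¹ = b * b⁻¹) : a * a⁻¹ * b = b := by
  rw [h, mul_inv_mul]

theorem mul_left_compat {a b : Q} (c : Q) (h : a * a⁻¹ = b * b⁻¹) :
    c * a * (c * a)⁻¹ = c * b * (c * b)⁻¹ := by
  rw [mul_inv_rev', mul_inv_rev']
  calc c * a * (a⁻¹ * c⁻¹) = c * (a * a⁻¹) * c⁻¹ := by simp only [mul_assoc]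
    _ = c * b * (b⁻¹ * c⁻¹) := by rw [h]; simp only [mul_assoc]

/-- If `y 𝓡 y * c`, then right multiplication by `c * c⁻¹` fixes `y`. -/
theorem mul_mul_inv_of_eq {y c : Q} (h : y * y⁻¹ = y * c * (y * c)⁻¹) : y * (c * c⁻¹) = y := by
  have k := idem_comm _ _ (inv_mul_idem y) (mul_inv_idem c)
  calc y * (c * c⁻¹) = y * (y⁻¹ * y * (c * c⁻¹)) := by
        rw [← mul_assoc y (y⁻¹ * y), ← mul_assoc y y⁻¹, mul_inv_mul]
    _ = y * c * (y * c)⁻¹ * y := by rw [k, mul_inv_rev']; simp only [mul_assoc]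
    _ = y := by rw [← h, mul_inv_mul]

/-- The Ore-type condition expressing `b * c⁻¹` as `x⁻¹ * y`. -/
theorem mul_inv_eq_inv_mul {b c x y : Q} (h₂ : y * y⁻¹ = y * c * (y * c)⁻¹)
    (h₃ : y * c = x * b) (h₄ : b * (c⁻¹ * c) = x⁻¹ * x * b) : b * c⁻¹ = x⁻¹ * y := by
  calc b * c⁻¹ = b * (c⁻¹ * c) * c⁻¹ := by rw [mul_assoc, inv_mul_inv]
    _ = x⁻¹ * (y * c) * c⁻¹ := by rw [h₄, h₃]; simp only [mul_assoc]
    _ = x⁻¹ * (y * (c * c⁻¹)) := by simp only [mul_assoc]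
    _ = x⁻¹ * y := by rw [mul_mul_inv_of_eq h₂]

theorem ore_of_mul_inv_eq {a b c d : Q} (h : a * b⁻¹ = c⁻¹ * d) (hR : c * c⁻¹ = d * d⁻¹) :
    d * d⁻¹ = d * b * (d * b)⁻¹ ∧ d * b = c * a ∧ a * (b⁻¹ * b) = c⁻¹ * c * a := by
  have hd : d = c * (a * b⁻¹) := by rw [h, ← mul_assoc, hR, mul_inv_mul]
  have hcc : c⁻¹ * c = a * (b⁻¹ * b) * a⁻¹ := by
    calc c⁻¹ * c = c⁻¹ * (c * c⁻¹) * c := by rw [← mul_assoc, inv_mul_inv]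
      _ = (c⁻¹ * d) * (c⁻¹ * d)⁻¹ := by
        rw [hR, mul_inv_rev', inv_inv']; simp only [mul_assoc]
      _ = a * (b⁻¹ * b) * a⁻¹ := by
        rw [← h, mul_inv_rev', inv_inv']; simp only [mul_assoc]
  have h₄ : a * (b⁻¹ * b) = c⁻¹ * c * a := by
    calc a * (b⁻¹ * b) = a * a⁻¹ * a * (b⁻¹ * b) := by rw [mul_inv_mul]
      _ = a * ((a⁻¹ * a) * (b⁻¹ * b)) := by simp only [mul_assoc]
      _ = c⁻¹ * c * a := by
        rw [idem_comm _ _ (inv_mul_idem a) (inv_mul_idem b), hcc]; simp only [mul_assoc]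
  have h₃ : d * b = c * a := by
    calc d * b = c * (a * (b⁻¹ * b)) := by rw [hd]; simp only [mul_assoc]
      _ = c * c⁻¹ * c * a := by rw [h₄]; simp only [mul_assoc]
      _ = c * a := by rw [mul_inv_mul]
  have h₅ : d * (b * b⁻¹) = d := by
    calc d * (b * b⁻¹) = c * (a * (b⁻¹ * b * b⁻¹)) := by rw [hd]; simp only [mul_assoc]
      _ = d := by rw [inv_mul_inv, hd]
  refine ⟨?_, h₃, h₄⟩
  calc d * d⁻¹ = d * (b * b⁻¹) * d⁻¹ := by rw [h₅]
    _ = d * b * (d * b)⁻¹ := by rw [mul_inv_rev']; simp only [mul_assoc]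

theorem inv_mul_compat {a b c : Q} (h : c * a * (c * a)⁻¹ = c * b * (c * b)⁻¹) :
    c⁻¹ * c * a * (c⁻¹ * c * a)⁻¹ = c⁻¹ * c * b * (c⁻¹ * c * b)⁻¹ := by
  simpa only [mul_assoc] using mul_left_compat c⁻¹ h

end InverseSemigroup

namespace PEquiv

open Classical in
/-- The partial equivalence given by a relation that is functional in both directions. -/
noncomputable def ofRel {D : Type*} (r : D → D → Prop)
    (h₁ : ∀ u v w, r u v → r u w → v = w) (h₂ : ∀ u v w, r u w → r v w → u = v) : D ≃. D where
  toFun u := if h : ∃ v, r u v then some h.choose else none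
  invFun v := if h : ∃ u, r u v then some h.choose else none
  inv u v := by
    have k₁ : u ∈ (if h : ∃ u, r u v then some h.choose else none) ↔ r u v := by
      split_ifs with h
      · rw [Option.mem_some_iff]
        exact ⟨fun e => e ▸ h.choose_spec, fun e => h₂ _ _ _ h.choose_spec e⟩
      · simpa using fun e => h ⟨u, e⟩
    have k₂ : v ∈ (if h : ∃ v, r u v then some h.choose else none) ↔ r u v := by
      split_ifs with h
      · rw [Option.mem_some_iff]
        exact ⟨fun e => e ▸ h.choose_spec, fun e => h₁ _ _ _ h.choose_spec e⟩
      · simpa using fun e => h ⟨v, e⟩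
    exact k₁.trans k₂.symm

theorem mem_ofRel {D : Type*} {r : D → D → Prop}
    {h₁ : ∀ u v w, r u v → r u w → v = w} {h₂ : ∀ u v w, r u w → r v w → u = v} {u v : D} :
    v ∈ ofRel r h₁ h₂ u ↔ r u v := by
  classical
  change v ∈ (if h : ∃ v, r u v then some h.choose else none) ↔ r u v
  split_ifs with h
  · rw [Option.mem_some_iff]
    exact ⟨fun e => e ▸ h.choose_spec, fun e => h₁ _ _ _ h.choose_spec e⟩
  · simpa using fun e => h ⟨v, e⟩

theorem ext_mem {D : Type*} {f g : D ≃. D} (h : ∀ u v, v ∈ f u ↔ v ∈ g u) : f = g :=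
  PEquiv.ext fun u => Option.ext fun v => h u v

theorem eq_of_mem_of_trans_self {D : Type*} {f : D ≃. D} (h : f.trans f = f) {u v : D}
    (hv : v ∈ f u) : u = v := by
  have hv' := hv
  rw [← h, mem_trans] at hv'
  obtain ⟨w, hw, hvw⟩ := hv'
  obtain rfl := Option.mem_unique hw hv
  exact f.inj hv hvw

/-- Partial self-equivalences form an inverse semigroup under composition. -/
instance inverseSemigroup (D : Type*) : InverseSemigroup (D ≃. D) where
  mul := PEquiv.trans
  inv := PEquiv.symm
  mul_assoc := PEquiv.trans_assoc
  mul_inv_mul f := ext_mem fun u v => by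
    change v ∈ (f.trans f.symm).trans f u ↔ _
    simp only [mem_trans, mem_iff_mem]
    constructor
    · rintro ⟨w, ⟨z, h₁, h₂⟩, h₃⟩
      obtain rfl := Option.mem_unique h₂ h₃
      exact h₁
    · exact fun h => ⟨u, ⟨v, h, h⟩, h⟩
  inv_mul_inv f := ext_mem fun u v => by
    change v ∈ (f.symm.trans f).trans f.symm u ↔ _
    simp only [mem_trans]
    constructor
    · rintro ⟨w, ⟨z, h₁, h₂⟩, h₃⟩
      rw [mem_iff_mem] at h₁ h₃
      obtain rfl := Option.mem_unique h₁ h₂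
      exact f.mem_iff_mem.2 h₃
    · exact fun h => ⟨u, ⟨v, h, f.mem_iff_mem.1 h⟩, h⟩
  idem_comm f g hf hg := ext_mem fun u v => by
    change f.trans f = f at hf
    change g.trans g = g at hg
    change v ∈ f.trans g u ↔ v ∈ g.trans f u
    simp only [mem_trans]
    constructor
    · rintro ⟨w, h₁, h₂⟩
      obtain rfl := eq_of_mem_of_trans_self hf h₁
      obtain rfl := eq_of_mem_of_trans_self hg h₂
      exact ⟨u, h₂, h₁⟩
    · rintro ⟨w, h₁, h₂⟩
      obtain rfl := eq_of_mem_of_trans_self hg h₁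
      obtain rfl := eq_of_mem_of_trans_self hf h₂
      exact ⟨u, h₂, h₁⟩

theorem mem_mul {D : Type*} {f g : D ≃. D} {u v : D} :
    v ∈ (f * g) u ↔ ∃ w, w ∈ f u ∧ v ∈ g w :=
  mem_trans f g u v

theorem mem_inv {D : Type*} {f : D ≃. D} {u v : D} : v ∈ f⁻¹ u ↔ u ∈ f v :=
  mem_iff_mem f

end PEquiv

/-- The elementary form of a right ample semigroup with a left compatible equivalence relation
satisfying the conditions for a straight left I-order. -/
structure StraightData {S : Type*} [Semigroup S] (star : S → S) (R : S → S → Prop) : Prop where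
  comm : ∀ e f : S, e * e = e → f * f = f → e * f = f * e
  idem : ∀ a : S, star a * star a = star a
  mul_star : ∀ a : S, a * star a = a
  cancel : ∀ a x y : S, a * x = a * y → star a * x = star a * y
  star_mul_of_mul : ∀ a x : S, a * x = a → star a * x = star a
  ample : ∀ a b : S, star a * b = b * star (a * b)
  equiv : Equivalence R
  compat : ∀ c a b : S, R a b → R (c * a) (c * b)
  ore : ∀ a b : S, ∃ c d : S, R c d ∧ R d (d * b) ∧ d * b = c * a ∧ a * star b = star c * a
  star_compat : ∀ a b c : S, R (c * a) (c * b) → R (star c * a) (star c * b)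
  mul_eq : ∀ a b x y : S, R a b → x * a = y * a → x * b = y * b
  mul_eq_self : ∀ a b x : S, R a b → x * a = a → x * b = b

namespace StraightData

variable {S : Type*} [Semigroup S] {star : S → S} {R : S → S → Prop}

theorem eq_of_idem (H : StraightData star R) {e f : S} (he : e * e = e) (hf : f * f = f)
    (h : R e f) : e = f := by
  rw [← H.mul_eq_self _ _ _ (H.equiv.symm h) hf, H.comm _ _ hf he, H.mul_eq_self _ _ _ h he]

theorem star_mul (H : StraightData star R) (a b : S) : star (a * b) = star (star a * b) := by
  have h₁ : star (a * b) * star (star a * b) = star (a * b) :=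
    H.star_mul_of_mul _ _ (by
      calc a * b * star (star a * b) = a * star a * b * star (star a * b) := by rw [H.mul_star]
        _ = a * (star a * b * star (star a * b)) := by simp only [mul_assoc]
        _ = a * b := by rw [H.mul_star, ← mul_assoc, H.mul_star])
  have h₂ : star (star a * b) * star (a * b) = star (star a * b) :=
    H.star_mul_of_mul _ _ (by
      rw [mul_assoc]
      exact H.cancel _ _ _ (by rw [← mul_assoc, H.mul_star]))
  rw [← h₁, H.comm _ _ (H.idem _) (H.idem _), h₂]

theorem star_mul_self_of_rel (H : StraightData star R) {x a : S} (h : R (star x) a) :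
    star x * a = a :=
  H.mul_eq_self _ _ _ h (H.idem x)

theorem star_mul_eq (H : StraightData star R) {x a b : S} (h : R (star x) a) (hab : R a b) :
    star (x * b) = star b := by
  rw [H.star_mul, H.star_mul_self_of_rel (H.equiv.trans h hab)]

theorem rel_star_mul (H : StraightData star R) {x a : S} (h : R x (x * a)) :
    R (star x) (star x * a) := by
  have := H.star_compat (star x) a x (by rwa [H.mul_star])
  rwa [H.idem] at this

theorem rel_mul_of_rel_star (H : StraightData star R) {x a : S} (h : R (star x) a) :
    R x (x * a) := by
  have := H.compat x _ _ h
  rwa [H.mul_star] at this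

theorem exists_rel_star (H : StraightData star R) (a : S) : ∃ x, R (star x) a := by
  obtain ⟨c, d, h₁, h₂, h₃, h₄⟩ := H.ore a a
  refine ⟨c, ?_⟩
  have := H.rel_star_mul (x := c) (a := a) (h₃ ▸ H.equiv.trans h₁ h₂)
  rwa [← h₄, H.mul_star] at this

theorem exists_idem_rel (H : StraightData star R) (a : S) : ∃ e, e * e = e ∧ R e a := by
  obtain ⟨x, hx⟩ := H.exists_rel_star a
  exact ⟨_, H.idem x, hx⟩

theorem mul_right_injective (H : StraightData star R) {x y a : S} (hx : R x (x * a))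
    (hy : R y (y * a)) (h : x * a = y * a) : x = y := by
  have hs : star x * a = star y * a := by rw [H.ample, H.ample, h]
  have hx' := H.rel_star_mul hx
  have hy' := H.rel_star_mul hy
  have he : star x = star y :=
    H.eq_of_idem (H.idem _) (H.idem _) (H.equiv.trans hx' (hs ▸ H.equiv.symm hy'))
  have := H.mul_eq _ _ x y (H.equiv.symm hx') (by
    rw [← mul_assoc, H.mul_star, he, ← mul_assoc, H.mul_star, h])
  rwa [H.mul_star, he, H.mul_star] at this

theorem rel_mul_of_rel_mul_mul (H : StraightData star R) {x a b : S} (h : R x (x * a * b)) :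
    R x (x * a) := by
  obtain ⟨e, he, hea⟩ := H.exists_idem_rel (x * a)
  obtain ⟨f, hf, hfx⟩ := H.exists_idem_rel x
  have h₁ : f * e = e := H.mul_eq_self _ _ _ (H.equiv.symm hea) (by
    rw [← mul_assoc, H.mul_eq_self _ _ _ hfx hf])
  have h₂ : e * f = f := H.mul_eq_self _ _ _ (H.equiv.symm (H.equiv.trans hfx h)) (by
    rw [← mul_assoc, H.mul_eq_self _ _ _ hea he])
  have hef : e = f := by rw [← h₁, H.comm _ _ hf he, h₂]
  exact H.equiv.trans (H.equiv.symm hfx) (hef ▸ hea)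

theorem ore_of_mul_star (H : StraightData star R) {x y : S} (h : x * star y = x) :
    ∃ p q, p * x = q * y ∧ R (star p) x ∧ R q (q * y) := by
  obtain ⟨p, q, h₁, h₂, h₃, h₄⟩ := H.ore x y
  rw [h] at h₄
  refine ⟨p, q, h₃.symm, ?_, h₂⟩
  have := H.rel_star_mul (x := p) (a := x) (h₃ ▸ H.equiv.trans h₁ h₂)
  rwa [← h₄] at this

theorem ore_of_star_eq (H : StraightData star R) {x y : S} (h : star x = star y) :
    ∃ p q, p * x = q * y ∧ R (star p) x ∧ R (star q) y := by
  obtain ⟨p, q, h₁, h₂, h₃⟩ := H.ore_of_mul_star (x := x) (y := y) (by rw [← h, H.mul_star])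
  refine ⟨p, q, h₁, h₂, ?_⟩
  have := H.rel_star_mul h₃
  rwa [H.ample, ← h₁, H.star_mul_eq h₂ (H.equiv.refl x), h, H.mul_star] at this

/-- Two pairs `(a, b)`, `(c, d)` represent the same formal fraction `a⁻¹ * b = c⁻¹ * d`. -/
def FracRel (star : S → S) (R : S → S → Prop) (p q : {p : S × S // R p.1 p.2}) : Prop :=
  ∃ x y, R (star x) p.1.1 ∧ R (star y) q.1.1 ∧ x * p.1.1 = y * q.1.1 ∧ x * p.1.2 = y * q.1.2

theorem fracRel_trans (H : StraightData star R) {p q r : {p : S × S // R p.1 p.2}}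
    (h : FracRel star R p q) (h' : FracRel star R q r) : FracRel star R p r := by
  obtain ⟨⟨a, b⟩, hab⟩ := p
  obtain ⟨⟨c, d⟩, hcd⟩ := q
  obtain ⟨⟨e, f⟩, hef⟩ := r
  obtain ⟨x, y, hx, hy, h₁, h₂⟩ := h
  obtain ⟨u, v, hu, hv, h₃, h₄⟩ := h'
  dsimp only at *
  have hyu : star y = star u :=
    H.eq_of_idem (H.idem _) (H.idem _) (H.equiv.trans hy (H.equiv.symm hu))
  obtain ⟨p, q, hpq, hp, hq⟩ := H.ore_of_star_eq hyu
  have hyx : R y x := H.equiv.trans (H.rel_mul_of_rel_star hy)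
    (h₁ ▸ H.equiv.symm (H.rel_mul_of_rel_star hx))
  have huv : R u v := H.equiv.trans (H.rel_mul_of_rel_star hu)
    (h₃ ▸ H.equiv.symm (H.rel_mul_of_rel_star hv))
  refine ⟨p * x, q * v, ?_, ?_, ?_, ?_⟩ <;> dsimp only
  · rwa [H.star_mul_eq hp hyx]
  · rwa [H.star_mul_eq hq huv]
  · rw [mul_assoc, h₁, ← mul_assoc, hpq, mul_assoc, h₃, mul_assoc]
  · rw [mul_assoc, h₂, ← mul_assoc, hpq, mul_assoc, h₄, mul_assoc]

/-- The setoid of formal fractions. -/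
def fracSetoid (H : StraightData star R) : Setoid {p : S × S // R p.1 p.2} where
  r := FracRel star R
  iseqv :=
    { refl := fun p => by
        obtain ⟨x, hx⟩ := H.exists_rel_star p.1.1
        exact ⟨x, x, hx, hx, rfl, rfl⟩
      symm := fun h => by
        obtain ⟨x, y, h₁, h₂, h₃, h₄⟩ := h
        exact ⟨y, x, h₂, h₁, h₃.symm, h₄.symm⟩
      trans := H.fracRel_trans }

/-- The set of formal fractions `a⁻¹ * b` with `R a b`. -/
def Frac (H : StraightData star R) := Quotient H.fracSetoid

/-- The formal fraction `a⁻¹ * b`. -/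
def frac (H : StraightData star R) (a b : S) (h : R a b) : H.Frac :=
  Quotient.mk H.fracSetoid ⟨(a, b), h⟩

theorem frac_eq_iff (H : StraightData star R) {a b c d : S} {h : R a b} {h' : R c d} :
    H.frac a b h = H.frac c d h' ↔
      ∃ x y, R (star x) a ∧ R (star y) c ∧ x * a = y * c ∧ x * b = y * d :=
  ⟨fun e => Quotient.exact (s := H.fracSetoid) e, fun e => Quotient.sound (s := H.fracSetoid) e⟩

theorem exists_frac (H : StraightData star R) (u : H.Frac) : ∃ a b h, u = H.frac a b h := by
  obtain ⟨⟨⟨a, b⟩, h⟩, rfl⟩ := Quotient.exists_rep u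
  exact ⟨a, b, h, rfl⟩

theorem star_eq_of_frac_eq (H : StraightData star R) {a b c d : S} {h : R a b} {h' : R c d}
    (e : H.frac a b h = H.frac c d h') : star b = star d := by
  obtain ⟨x, y, hx, hy, -, h₂⟩ := H.frac_eq_iff.1 e
  rw [← H.star_mul_eq hx h, h₂, H.star_mul_eq hy h']

/-- The partial action of `s` by right multiplication on formal fractions, as a relation. -/
def ActRel (H : StraightData star R) (s : S) (u v : H.Frac) : Prop :=
  ∃ (a b : S) (h : R a b) (h' : R b (b * s)),
    u = H.frac a b h ∧ v = H.frac a (b * s) (H.equiv.trans h h')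

theorem actRel_frac_left (H : StraightData star R) {s a b : S} {h : R a b} {v : H.Frac} :
    H.ActRel s (H.frac a b h) v ↔
      ∃ h' : R b (b * s), v = H.frac a (b * s) (H.equiv.trans h h') := by
  constructor
  · rintro ⟨c, d, hcd, hds, e, rfl⟩
    have hs := H.rel_star_mul hds
    rw [← H.star_eq_of_frac_eq e] at hs
    have hb : R b (b * s) := by
      have := H.compat b _ _ hs
      rwa [← mul_assoc, H.mul_star] at this
    obtain ⟨x, y, hx, hy, h₁, h₂⟩ := H.frac_eq_iff.1 e
    exact ⟨hb, H.frac_eq_iff.2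
      ⟨y, x, hy, hx, h₁.symm, by rw [← mul_assoc, ← h₂, mul_assoc]⟩⟩
  · rintro ⟨h', rfl⟩
    exact ⟨a, b, h, h', rfl, rfl⟩

theorem actRel_right_unique (H : StraightData star R) (s : S) (u v w : H.Frac)
    (h₁ : H.ActRel s u v) (h₂ : H.ActRel s u w) : v = w := by
  obtain ⟨a, b, h, rfl⟩ := H.exists_frac u
  obtain ⟨_, rfl⟩ := H.actRel_frac_left.1 h₁
  obtain ⟨_, rfl⟩ := H.actRel_frac_left.1 h₂
  rfl

theorem actRel_left_unique (H : StraightData star R) (s : S) (u v w : H.Frac)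
    (h₁ : H.ActRel s u w) (h₂ : H.ActRel s v w) : u = v := by
  obtain ⟨a, b, hab, hb, rfl, rfl⟩ := h₁
  obtain ⟨c, d, hcd, hd, rfl, e⟩ := h₂
  obtain ⟨x, y, hx, hy, h₁, h₂⟩ := H.frac_eq_iff.1 e
  refine H.frac_eq_iff.2 ⟨x, y, hx, hy, h₁, ?_⟩
  rw [← mul_assoc, ← mul_assoc] at h₂
  refine H.mul_right_injective ?_ ?_ h₂
  · rw [mul_assoc]; exact H.compat _ _ _ hb
  · rw [mul_assoc]; exact H.compat _ _ _ hd

theorem exists_actRel_iff (H : StraightData star R) {s a b : S} {h : R a b} :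
    (∃ u, H.ActRel s u (H.frac a b h)) ↔ b * star s = b := by
  constructor
  · rintro ⟨_, c, d, hcd, hd, -, e⟩
    have hs : star (d * s) * star s = star (d * s) :=
      H.star_mul_of_mul _ _ (by rw [mul_assoc, H.mul_star])
    rw [← H.star_eq_of_frac_eq e] at hs
    calc b * star s = b * (star b * star s) := by rw [← mul_assoc, H.mul_star]
      _ = b := by rw [hs, H.mul_star]
  · intro hb
    obtain ⟨p, q, h₁, h₂, h₃⟩ := H.ore_of_mul_star hb
    have hpa : R (p * a) q := H.equiv.trans (H.compat p _ _ h) (h₁ ▸ H.equiv.symm h₃)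
    refine ⟨H.frac (p * a) q hpa, H.actRel_frac_left.2 ⟨h₃, ?_⟩⟩
    obtain ⟨x, hx⟩ := H.exists_rel_star (p * a)
    refine H.frac_eq_iff.2 ⟨x * p, x, ?_, hx, mul_assoc _ _ _, by rw [mul_assoc, h₁]⟩
    have hpp : R (p * a) p :=
      H.equiv.symm (H.rel_mul_of_rel_star (H.equiv.trans h₂ (H.equiv.symm h)))
    rw [H.star_mul_eq hx hpp]
    exact H.equiv.trans h₂ (H.equiv.symm h)

/-- The representation of `S` by partial bijections of the set of formal fractions. -/
noncomputable def rep (H : StraightData star R) (s : S) : H.Frac ≃. H.Frac :=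
  PEquiv.ofRel (H.ActRel s) (H.actRel_right_unique s) (H.actRel_left_unique s)

theorem mem_rep (H : StraightData star R) {s : S} {u v : H.Frac} :
    v ∈ H.rep s u ↔ H.ActRel s u v :=
  PEquiv.mem_ofRel

theorem rep_mul (H : StraightData star R) (s t : S) : H.rep (s * t) = H.rep s * H.rep t := by
  refine PEquiv.ext_mem fun u v => ?_
  obtain ⟨a, b, h, rfl⟩ := H.exists_frac u
  simp only [PEquiv.mem_mul, mem_rep]
  constructor
  · intro hv
    obtain ⟨h', rfl⟩ := H.actRel_frac_left.1 hv
    have h₁ : R b (b * s) := H.rel_mul_of_rel_mul_mul (by rwa [mul_assoc])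
    refine ⟨_, H.actRel_frac_left.2 ⟨h₁, rfl⟩, H.actRel_frac_left.2 ⟨?_, ?_⟩⟩
    · rw [mul_assoc]; exact H.equiv.trans (H.equiv.symm h₁) h'
    · simp only [mul_assoc]
  · rintro ⟨w, h₁, h₂⟩
    obtain ⟨h₃, rfl⟩ := H.actRel_frac_left.1 h₁
    obtain ⟨h₄, rfl⟩ := H.actRel_frac_left.1 h₂
    refine H.actRel_frac_left.2 ⟨?_, ?_⟩
    · rw [← mul_assoc]; exact H.equiv.trans h₃ h₄
    · simp only [mul_assoc]

theorem rep_star (H : StraightData star R) (s : S) :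
    H.rep (star s) = (H.rep s)⁻¹ * H.rep s := by
  refine PEquiv.ext_mem fun u v => ?_
  obtain ⟨a, b, h, rfl⟩ := H.exists_frac u
  simp only [PEquiv.mem_mul, PEquiv.mem_inv, mem_rep]
  constructor
  · intro hv
    obtain ⟨h', rfl⟩ := H.actRel_frac_left.1 hv
    have hb : b * star s = b := by
      refine H.mul_right_injective (a := star s) ?_ h' ?_
      · rw [mul_assoc, H.idem]; exact H.equiv.refl _
      · rw [mul_assoc, H.idem]
    obtain ⟨w, hw⟩ := H.exists_actRel_iff (h := h).2 hb
    simp only [hb]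
    exact ⟨w, hw, hw⟩
  · rintro ⟨w, h₁, h₂⟩
    obtain rfl := H.actRel_right_unique _ _ _ _ h₁ h₂
    have hb := H.exists_actRel_iff.1 ⟨w, h₁⟩
    refine H.actRel_frac_left.2 ⟨by rw [hb]; exact H.equiv.refl _, ?_⟩
    simp only [hb]

theorem mem_rep_mul_inv (H : StraightData star R) {s a b : S} {h : R a b} {v : H.Frac} :
    v ∈ (H.rep s * (H.rep s)⁻¹) (H.frac a b h) ↔ R b (b * s) ∧ v = H.frac a b h := by
  simp only [PEquiv.mem_mul, PEquiv.mem_inv, mem_rep]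
  constructor
  · rintro ⟨w, h₁, h₂⟩
    exact ⟨(H.actRel_frac_left.1 h₁).1, H.actRel_left_unique _ _ _ _ h₂ h₁⟩
  · rintro ⟨h', rfl⟩
    have := H.actRel_frac_left (h := h).2 ⟨h', rfl⟩
    exact ⟨_, this, this⟩

theorem rel_iff_rep (H : StraightData star R) (s t : S) :
    R s t ↔ H.rep s * (H.rep s)⁻¹ = H.rep t * (H.rep t)⁻¹ := by
  constructor
  · intro hst
    refine PEquiv.ext_mem fun u v => ?_
    obtain ⟨a, b, h, rfl⟩ := H.exists_frac u
    have hb := H.compat b _ _ hst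
    rw [mem_rep_mul_inv, mem_rep_mul_inv]
    exact and_congr_left fun _ =>
      ⟨fun k => H.equiv.trans k hb, fun k => H.equiv.trans k (H.equiv.symm hb)⟩
  · intro hst
    have key : ∀ s t : S, H.rep s * (H.rep s)⁻¹ = H.rep t * (H.rep t)⁻¹ →
        ∀ e f, e * e = e → f * f = f → R e s → R f t → e * f = e := by
      intro s t hst e f he hf hes hft
      have h₁ : H.frac e e (H.equiv.refl e) ∈
          (H.rep s * (H.rep s)⁻¹) (H.frac e e (H.equiv.refl e)) :=
        H.mem_rep_mul_inv.2 ⟨by rwa [H.mul_eq_self _ _ _ hes he], rfl⟩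
      rw [hst, mem_rep_mul_inv] at h₁
      refine (H.eq_of_idem he ?_ (H.equiv.trans h₁.1 (H.compat e _ _ (H.equiv.symm hft)))).symm
      rw [mul_assoc, ← mul_assoc f, ← H.comm _ _ he hf, mul_assoc, hf, ← mul_assoc, he]
    obtain ⟨e, he, hes⟩ := H.exists_idem_rel s
    obtain ⟨f, hf, hft⟩ := H.exists_idem_rel t
    have hef : e = f := by
      rw [← key s t hst e f he hf hes hft, H.comm _ _ he hf, key t s hst.symm f e hf he hft hes]
    exact H.equiv.trans (H.equiv.symm hes) (hef ▸ hft)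

theorem rep_injective (H : StraightData star R) : Function.Injective H.rep := by
  intro s t hst
  obtain ⟨e, he, hes⟩ := H.exists_idem_rel s
  have hR : R s t := (H.rel_iff_rep s t).2 (by rw [hst])
  have hs : e * s = s := H.mul_eq_self _ _ _ hes he
  have ht : e * t = t := H.mul_eq_self _ _ _ (H.equiv.trans hes hR) he
  have hm := H.mem_rep.2 (H.actRel_frac_left (s := s) (h := H.equiv.refl e).2
    ⟨by rwa [hs], rfl⟩)
  rw [hst, mem_rep, actRel_frac_left] at hm
  obtain ⟨_, hm⟩ := hm
  obtain ⟨x, y, hx, hy, h₁, h₂⟩ := H.frac_eq_iff.1 hm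
  have hxe : star x = e := H.eq_of_idem (H.idem x) he hx
  have hye : star y = e := H.eq_of_idem (H.idem y) he hy
  have hxy : x = y := by
    calc x = x * e := by rw [← hxe, H.mul_star]
      _ = y := by rw [h₁, ← hye, H.mul_star]
  rw [hs, ht, ← hxy] at h₂
  have := H.cancel _ _ _ h₂
  rwa [hxe, hs, ht] at this

open InverseSemigroup in
/-- The partial bijections of the form `(rep a)⁻¹ * rep b` with `R a b` are closed under
composition. -/
theorem exists_mul_eq (H : StraightData star R) {a b c d : S} (hab : R a b) (hcd : R c d) :
    ∃ m n, R m n ∧ (H.rep a)⁻¹ * H.rep b * ((H.rep c)⁻¹ * H.rep d) = (H.rep m)⁻¹ * H.rep n := by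
  obtain ⟨x, y, h₁, h₂, h₃, h₄⟩ := H.ore b c
  refine ⟨x * a, y * d, H.equiv.trans (H.compat x _ _ hab) (h₃ ▸ H.compat y _ _ hcd), ?_⟩
  have key : H.rep b * (H.rep c)⁻¹ = (H.rep x)⁻¹ * H.rep y := by
    refine mul_inv_eq_inv_mul ?_ ?_ ?_
    · rw [← rep_mul]; exact (H.rel_iff_rep _ _).1 h₂
    · rw [← rep_mul, ← rep_mul, h₃]
    · rw [← rep_star, ← rep_star, ← rep_mul, ← rep_mul, h₄]
  calc (H.rep a)⁻¹ * H.rep b * ((H.rep c)⁻¹ * H.rep d)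
      = (H.rep a)⁻¹ * (H.rep b * (H.rep c)⁻¹) * H.rep d := by simp only [mul_assoc]
    _ = (H.rep (x * a))⁻¹ * H.rep (y * d) := by
      rw [key, rep_mul, rep_mul, mul_inv_rev']; simp only [mul_assoc]

open InverseSemigroup in
theorem exists_rep_eq (H : StraightData star R) (a : S) :
    ∃ m n, R m n ∧ H.rep a = (H.rep m)⁻¹ * H.rep n := by
  obtain ⟨e, he, hea⟩ := H.exists_idem_rel a
  exact ⟨e, a, hea, by
    rw [inv_eq_self (by rw [← rep_mul, he]), ← rep_mul, H.mul_eq_self _ _ _ hea he]⟩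

/-- The semigroup of straight left I-quotients, as partial bijections of formal fractions. -/
def IQuotients (H : StraightData star R) :=
  {q : H.Frac ≃. H.Frac // ∃ a b, R a b ∧ q = (H.rep a)⁻¹ * H.rep b}

open InverseSemigroup in
instance (H : StraightData star R) : InverseSemigroup H.IQuotients where
  mul p q := ⟨p.1 * q.1, by
    obtain ⟨_, a, b, hab, rfl⟩ := p
    obtain ⟨_, c, d, hcd, rfl⟩ := q
    exact H.exists_mul_eq hab hcd⟩
  inv p := ⟨p.1⁻¹, by
    obtain ⟨_, a, b, hab, rfl⟩ := p
    exact ⟨b, a, H.equiv.symm hab, by rw [mul_inv_rev', inv_inv']⟩⟩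
  mul_assoc p q r := Subtype.ext (mul_assoc p.1 q.1 r.1)
  mul_inv_mul p := Subtype.ext (mul_inv_mul p.1)
  inv_mul_inv p := Subtype.ext (inv_mul_inv p.1)
  idem_comm p q hp hq := Subtype.ext
    (idem_comm p.1 q.1 (congrArg Subtype.val hp) (congrArg Subtype.val hq))

/-- The embedding of `S` into its semigroup of straight left I-quotients. -/
noncomputable def embed (H : StraightData star R) (a : S) : H.IQuotients :=
  ⟨H.rep a, H.exists_rep_eq a⟩

theorem rel_iff_embed (H : StraightData star R) (a b : S) :
    R a b ↔ H.embed a * (H.embed a)⁻¹ = H.embed b * (H.embed b)⁻¹ :=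
  (H.rel_iff_rep a b).trans ⟨fun h => Subtype.ext h, fun h => congrArg Subtype.val h⟩

end StraightData

open InverseSemigroup in
theorem RStar.of_injective {S Q : Type*} [Semigroup S] [InverseSemigroup Q] {φ : S → Q}
    (hmul : ∀ a b : S, φ (a * b) = φ a * φ b) (hinj : Function.Injective φ) {a b : S}
    (hab : φ a * (φ a)⁻¹ = φ b * (φ b)⁻¹) : RStar a b := by
  have key₂ : ∀ a b x y : S, φ a * (φ a)⁻¹ = φ b * (φ b)⁻¹ → x * a = y * a → x * b = y * b := by
    intro a b x y hab h
    apply hinj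
    rw [hmul, hmul, ← mul_inv_mul_of_eq hab, ← mul_assoc, ← mul_assoc, ← mul_assoc, ← mul_assoc,
      ← hmul, ← hmul, h]
  have key₁ : ∀ a b x : S, φ a * (φ a)⁻¹ = φ b * (φ b)⁻¹ → x * a = a → x * b = b := by
    intro a b x hab h
    apply hinj
    rw [hmul, ← mul_inv_mul_of_eq hab, ← mul_assoc, ← mul_assoc, ← hmul, h]
  have key : ∀ a b : S, φ a * (φ a)⁻¹ = φ b * (φ b)⁻¹ → ∀ x y : WithOne S,
      x * (a : WithOne S) = y * (a : WithOne S) → x * (b : WithOne S) = y * (b : WithOne S) := by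
    intro a b hab x y
    cases x <;> cases y
    · exact fun _ => rfl
    · simp only [one_mul, ← WithOne.coe_mul, WithOne.coe_inj]
      exact fun h => (key₁ a b _ hab h.symm).symm
    · simp only [one_mul, ← WithOne.coe_mul, WithOne.coe_inj]
      exact fun h => key₁ a b _ hab h
    · simp only [← WithOne.coe_mul, WithOne.coe_inj]
      exact fun h => key₂ a b _ _ hab h
  exact fun x y => ⟨key a b hab x y, key b a hab.symm x y⟩

/-- Theorem `rightample`: a right ample semigroup `S` has a semigroup
of straight left I-quotients in which it embeds as a unary semigroup, realizing `R'`
as the restriction of 𝓡, iff `R'` is a left compatible equivalence relation and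
conditions (A1)-(A3) hold. -/
theorem right_ample_straight_leftIOrder
    {S : Type u} [Semigroup S] (star : S → S)
    (hcomm : ∀ e f : S, e * e = e → f * f = f → e * f = f * e)
    (hidem : ∀ a : S, star a * star a = star a)
    (hLstar : ∀ a : S, LeLStar a (star a) ∧ LeLStar (star a) a)
    (hample : ∀ a b : S, star a * b = b * star (a * b))
    (R : S → S → Prop) :
    (∃ (Q : Type u) (mul : Q → Q → Q) (inv : Q → Q) (φ : S → Q),
      (∀ a b c : Q, mul (mul a b) c = mul a (mul b c)) ∧
      (∀ a : Q, mul (mul a (inv a)) a = a) ∧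
      (∀ a : Q, mul (mul (inv a) a) (inv a) = inv a) ∧
      (∀ e f : Q, mul e e = e → mul f f = f → mul e f = mul f e) ∧
      (∀ a b : S, φ (a * b) = mul (φ a) (φ b)) ∧
      Function.Injective φ ∧
      (∀ a : S, φ (star a) = mul (inv (φ a)) (φ a)) ∧
      (∀ q : Q, ∃ a b : S,
        q = mul (inv (φ a)) (φ b) ∧ mul (φ a) (inv (φ a)) = mul (φ b) (inv (φ b))) ∧
      (∀ a b : S, R a b ↔ mul (φ a) (inv (φ a)) = mul (φ b) (inv (φ b)))) ↔
    (Equivalence R ∧ LeftCompatible R ∧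
      (∀ a b : S, ∃ c d : S,
        R c d ∧ R d (d * b) ∧ d * b = c * a ∧ a * star b = star c * a) ∧
      (∀ a b c : S, R (c * a) (c * b) → R (star c * a) (star c * b)) ∧
      (∀ a b : S, R a b → RStar a b)) := by
  constructor
  · rintro ⟨Q, mul, inv, φ, hassoc, h₁, h₂, h₃, hmul, hinj, hstar, hq, hR⟩
    let _ : InverseSemigroup Q :=
      { mul := mul
        inv := inv
        mul_assoc := hassoc
        mul_inv_mul := h₁
        inv_mul_inv := h₂
        idem_comm := h₃ }
    change ∀ a b : S, φ (a * b) = φ a * φ b at hmul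
    change ∀ a : S, φ (star a) = (φ a)⁻¹ * φ a at hstar
    change ∀ q : Q, ∃ a b : S, q = (φ a)⁻¹ * φ b ∧ φ a * (φ a)⁻¹ = φ b * (φ b)⁻¹ at hq
    change ∀ a b : S, R a b ↔ φ a * (φ a)⁻¹ = φ b * (φ b)⁻¹ at hR
    refine ⟨⟨fun a => (hR a a).2 rfl, fun h => (hR _ _).2 ((hR _ _).1 h).symm,
      fun h k => (hR _ _).2 (((hR _ _).1 h).trans ((hR _ _).1 k))⟩, ?_, ?_, ?_, ?_⟩
    · intro c a b h
      rw [hR, hmul, hmul]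
      exact InverseSemigroup.mul_left_compat _ ((hR _ _).1 h)
    · intro a b
      obtain ⟨c, d, h, hcd⟩ := hq (φ a * (φ b)⁻¹)
      obtain ⟨k₁, k₂, k₃⟩ := InverseSemigroup.ore_of_mul_inv_eq h hcd
      refine ⟨c, d, (hR _ _).2 hcd, (hR _ _).2 (by rwa [hmul]), hinj ?_, hinj ?_⟩
      · rwa [hmul, hmul]
      · rwa [hmul, hmul, hstar, hstar]
    · intro a b c h
      rw [hR, hmul, hmul] at h
      rw [hR, hmul, hmul, hstar]
      exact InverseSemigroup.inv_mul_compat h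
    · exact fun a b h => RStar.of_injective hmul hinj ((hR a b).1 h)
  · rintro ⟨hequiv, hcompat, hA₁, hA₂, hA₃⟩
    have hcancel : ∀ a x : S, a * x = a → star a * x = star a := by
      intro a x h
      have := (hLstar a).2 x 1 (by rw [mul_one, ← WithOne.coe_mul, h])
      rwa [mul_one, ← WithOne.coe_mul, WithOne.coe_inj] at this
    have H : StraightData star R :=
      { comm := hcomm
        idem := hidem
        mul_star := fun a => by
          have := (hLstar a).1 (star a) 1 (by rw [mul_one, ← WithOne.coe_mul, hidem])
          rwa [mul_one, ← WithOne.coe_mul, WithOne.coe_inj] at this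
        cancel := fun a x y h => by
          have := (hLstar a).2 x y (by rw [← WithOne.coe_mul, ← WithOne.coe_mul, h])
          rwa [← WithOne.coe_mul, ← WithOne.coe_mul, WithOne.coe_inj] at this
        star_mul_of_mul := hcancel
        ample := hample
        equiv := hequiv
        compat := hcompat
        ore := hA₁
        star_compat := hA₂
        mul_eq := fun a b x y h k => by
          have := (hA₃ a b h x y).1 (by rw [← WithOne.coe_mul, ← WithOne.coe_mul, k])
          rwa [← WithOne.coe_mul, ← WithOne.coe_mul, WithOne.coe_inj] at this
        mul_eq_self := fun a b x h k => by
          have := (hA₃ a b h x 1).1 (by rw [one_mul, ← WithOne.coe_mul, k])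
          rwa [one_mul, ← WithOne.coe_mul, WithOne.coe_inj] at this }
    refine ⟨H.IQuotients, fun p q => p * q, fun p => p⁻¹, H.embed, mul_assoc,
      InverseSemigroup.mul_inv_mul, InverseSemigroup.inv_mul_inv, InverseSemigroup.idem_comm,
      fun a b => Subtype.ext (H.rep_mul a b),
      fun a b h => H.rep_injective (congrArg Subtype.val h),
      fun a => Subtype.ext (H.rep_star a), ?_, H.rel_iff_embed⟩
    rintro ⟨q, a, b, hab, rfl⟩
    exact ⟨a, b, rfl, (H.rel_iff_embed a b).1 hab⟩
end
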